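/- Let M ⪯ N be models of a complete NIP first-order L-theory, with N sufficiently saturated. Let q(y) be a complete type over M and let (b_n)_{n∈ℕ} be a strict Morley sequence for q(y) in N. Let B be a finite set of tuples from N, each realizing q. Then there is a sequence (d_n)_{n∈ℤ, n≠0} of tuples from N such that for each d ∈ B, the sequence (..., d_{-2}, d_{-1}, d, d_1, d_2, ...) (with d inserted at position 0) is indiscernible over M and has the same Ehrenfeucht–Mostowski type over M as (b_n)_{n∈ℕ}. -/

import Mathlib

open FirstOrder FirstOrder.Language

universe u v w

namespace DistalPaper

variable (L : FirstOrder.Language.{u, v})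

def SameTypeOver {N : Type w} [L.Structure N] (A : Set N) {γ : Type*} (b b' : γ → N) : Prop :=
  ∀ (p : ℕ) (φ : L.Formula (γ ⊕ Fin p)) (m : Fin p → N), (∀ i, m i ∈ A) →
    (φ.Realize (Sum.elim b m) ↔ φ.Realize (Sum.elim b' m))

def IsIndiscernibleOver {N : Type w} [L.Structure N] (A : Set N) {I : Type*} [LinearOrder I]
    {γ : Type*} (b : I → γ → N) : Prop :=
  ∀ (m : ℕ) (i j : Fin m → I), StrictMono i → StrictMono j →
    SameTypeOver L A (fun q : Fin m × γ => b (i q.1) q.2) (fun q : Fin m × γ => b (j q.1) q.2)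

def IsConsistentFamily {N : Type w} [L.Structure N] {α γ ι : Type*}
    (φ : L.Formula (α ⊕ γ)) (b : ι → γ → N) : Prop :=
  ∀ s : Finset ι, ∃ a : α → N, ∀ i ∈ s, φ.Realize (Sum.elim a (b i))

structure ElemExt (N : Type w) [L.Structure N] where
  Carrier : Type max u v w
  [str : L.Structure Carrier]
  emb : N ↪ₑ[L] Carrier

attribute [instance] ElemExt.str

def Divides {N : Type w} [L.Structure N] (A : Set N) {α γ : Type*}
    (φ : L.Formula (α ⊕ γ)) (b : γ → N) : Prop :=
  ∃ (E : ElemExt L N) (c : ℕ → γ → E.Carrier),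
    IsIndiscernibleOver L (⇑E.emb '' A) c ∧
    SameTypeOver L (⇑E.emb '' A) (c 0) (⇑E.emb ∘ b) ∧
    ¬ IsConsistentFamily L φ c

/-- The formula `φ(x, b)` forks over `A`: in some elementary extension it implies a finite
disjunction of formulas, each of which divides over (the image of) `A`. -/
def Forks {N : Type w} [L.Structure N] (A : Set N) {α γ : Type*}
    (φ : L.Formula (α ⊕ γ)) (b : γ → N) : Prop :=
  ∃ (E : ElemExt L N) (k m : ℕ) (ψ : Fin k → L.Formula (α ⊕ Fin m))
    (c : Fin k → Fin m → E.Carrier),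
    (∀ i, Divides L (⇑E.emb '' A) (ψ i) (c i)) ∧
    ∀ a : α → E.Carrier, φ.Realize (Sum.elim a (⇑E.emb ∘ b)) →
      ∃ i, (ψ i).Realize (Sum.elim a (c i))

/-- The complete type of the tuple `bs` over the parameter set `P` does not fork over `A`:
no formula with parameters from `P` satisfied by `bs` forks over `A`. -/
def TypeDoesNotForkOver {N : Type w} [L.Structure N] (A P : Set N) {β : Type*}
    (bs : β → N) : Prop :=
  ∀ (p : ℕ) (φ : L.Formula (β ⊕ Fin p)) (c : Fin p → N), (∀ i, c i ∈ P) →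
    φ.Realize (Sum.elim bs c) → ¬ Forks L A φ c

/-- `tp(a / A ∪ bs)` is strictly non-forking over `A`: it extends to a complete type `p`
over a monster model (an elementary extension `E` of `N`, realized by `a'` in a further
elementary extension `F`) such that `p` does not fork over `A` and, for the realization
`a'` of `p`, `tp(bs / A a')` does not fork over `A`. -/
def StrictlyNonForkingOver {N : Type w} [L.Structure N] (A : Set N) {α β : Type*}
    (a : α → N) (bs : β → N) : Prop :=
  ∃ (E : ElemExt L N) (F : ElemExt L E.Carrier) (a' : α → F.Carrier),
    SameTypeOver L ((⇑F.emb ∘ ⇑E.emb) '' (A ∪ Set.range bs)) a' (⇑F.emb ∘ ⇑E.emb ∘ a) ∧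
    TypeDoesNotForkOver L ((⇑F.emb ∘ ⇑E.emb) '' A) (Set.range ⇑F.emb) a' ∧
    TypeDoesNotForkOver L ((⇑F.emb ∘ ⇑E.emb) '' A)
      (((⇑F.emb ∘ ⇑E.emb) '' A) ∪ Set.range a') (⇑F.emb ∘ ⇑E.emb ∘ bs)

/-- `b` is a strict Morley sequence over `A` for the complete type (over `A`) of the
tuple `q`: an `A`-indiscernible sequence of realizations of `tp(q/A)` such that each
`tp(b (n+1) / A, b 0, ..., b n)` is strictly non-forking over `A`. -/
def IsStrictMorleySequence {N : Type w} [L.Structure N] (A : Set N) {γ : Type*}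
    (q : γ → N) (b : ℕ → γ → N) : Prop :=
  IsIndiscernibleOver L A b ∧
  (∀ n, SameTypeOver L A (b n) q) ∧
  ∀ n : ℕ, StrictlyNonForkingOver L A (b (n + 1)) (fun p : Fin (n + 1) × γ => b ↑p.1 p.2)

/-- `N` (equivalently, its complete theory) is NIP: no formula `φ(x, y)` has the
independence property in any model of `Th(N)`. -/
def IsNIP (N : Type w) [L.Structure N] : Prop :=
  ∀ (nx ny : ℕ) (φ : L.Formula (Fin nx ⊕ Fin ny)),
    ¬ ∃ (K : Theory.ModelType.{u, v, max u v w} (L.completeTheory N))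
        (a : ℕ → Fin nx → K) (bS : Set ℕ → Fin ny → K),
        ∀ (i : ℕ) (S : Set ℕ), φ.Realize (Sum.elim (a i) (bS S)) ↔ i ∈ S

/-- `N` is distal: it is NIP and, in every elementary extension, for every indiscernible
sequence `(b i)_{i ∈ ℤ}` and parameter set `A`, if the sequence with `b 0` omitted is
indiscernible over `A`, then the whole sequence is indiscernible over `A`. -/
def IsDistal (N : Type w) [L.Structure N] : Prop :=
  IsNIP L N ∧
  ∀ (E : ElemExt L N) (m : ℕ) (b : ℤ → Fin m → E.Carrier) (A : Set E.Carrier),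
    IsIndiscernibleOver L (∅ : Set E.Carrier) b →
    IsIndiscernibleOver L A (fun i : {i : ℤ // i ≠ 0} => b ↑i) →
    IsIndiscernibleOver L A b

/-- `N` is `κ`-saturated: every finitely satisfiable family of formulas in finitely many
free variables with parameters from a set of size `< κ` is realized in `N`. -/
def IsSaturated (κ : Cardinal.{w}) (N : Type w) [L.Structure N] : Prop :=
  ∀ (A : Set N), Cardinal.mk A < κ →
    ∀ (n : ℕ) (ι : Type max u v w) (p : ι → ℕ) (φ : ∀ i, L.Formula (Fin n ⊕ Fin (p i)))
      (c : ∀ i, Fin (p i) → N), (∀ i j, c i j ∈ A) →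
      (∀ s : Finset ι, ∃ a : Fin n → N, ∀ i ∈ s, (φ i).Realize (Sum.elim a (c i))) →
      ∃ a : Fin n → N, ∀ i, (φ i).Realize (Sum.elim a (c i))

/-- The complete type of `a` over the parameter set `P` (with `A ⊆ P`) extends to a
complete type over all of `N` which is `A`-invariant; the extension is encoded by a
realization `a'` in an elementary extension of `N`. -/
def ExtendsToInvariantType {N : Type w} [L.Structure N] (A P : Set N) {α : Type*}
    (a : α → N) : Prop :=
  ∃ (E : ElemExt L N) (a' : α → E.Carrier),
    SameTypeOver L (⇑E.emb '' P) a' (⇑E.emb ∘ a) ∧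
    ∀ (p : ℕ) (φ : L.Formula (α ⊕ Fin p)) (c c' : Fin p → N),
      SameTypeOver L A c c' →
      (φ.Realize (Sum.elim a' (⇑E.emb ∘ c)) ↔ φ.Realize (Sum.elim a' (⇑E.emb ∘ c')))

/-- Two sequences have the same Ehrenfeucht–Mostowski type over `A`: increasing tuples
of the same length from either sequence have the same type over `A`. -/
def SameEMTypeOver {N : Type w} [L.Structure N] (A : Set N) {I J : Type*}
    [LinearOrder I] [LinearOrder J] {γ : Type*} (b : I → γ → N) (d : J → γ → N) : Prop :=
  ∀ (m : ℕ) (i : Fin m → I) (j : Fin m → J), StrictMono i → StrictMono j →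
    SameTypeOver L A (fun q : Fin m × γ => b (i q.1) q.2) (fun q : Fin m × γ => d (j q.1) q.2)

/-- Insert the tuple `d` at position `0` into a sequence indexed by the nonzero integers. -/
def insertAtZero {X γ : Type*} (d : γ → X) (ds : {i : ℤ // i ≠ 0} → γ → X) : ℤ → γ → X :=
  fun i => if h : i = 0 then d else ds ⟨i, h⟩


section Aux
variable {L}

/-! ### Basic facts about types and formulas -/

theorem fin_support {β P : Type*} (φ : L.Formula (β ⊕ P)) :
    ∃ (p : ℕ) (φ' : L.Formula (β ⊕ Fin p)) (m : Fin p → P),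
      ∀ (K : Type w) [L.Structure K] (b : β → K) (c : P → K),
        φ'.Realize (Sum.elim b (c ∘ m)) ↔ φ.Realize (Sum.elim b c) := by
  classical
  let s : Finset P := φ.freeVarFinset.toRight
  let e : s ≃ Fin s.card := s.equivFin
  refine ⟨s.card, BoundedFormula.restrictFreeVar φ (fun x => match x with
    | ⟨Sum.inl x, _⟩ => Sum.inl x
    | ⟨Sum.inr x, h⟩ => Sum.inr (e ⟨x, Finset.mem_toRight.2 h⟩)), fun i => (e.symm i : P), ?_⟩
  intro K _ b c
  refine BoundedFormula.realize_restrictFreeVar _ ?_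
  rintro ⟨x | x, h⟩
  · rfl
  · simp

theorem sameTypeOver_range_iff {K : Type*} [L.Structure K] {P γ : Type*} (c : P → K)
    (b b' : γ → K) :
    SameTypeOver L (Set.range c) b b' ↔
      ∀ φ : L.Formula (γ ⊕ P), φ.Realize (Sum.elim b c) ↔ φ.Realize (Sum.elim b' c) := by
  constructor
  · intro h φ
    obtain ⟨p, φ', m, hm⟩ := fin_support φ
    rw [← hm, ← hm]
    exact h p φ' _ (fun i => ⟨m i, rfl⟩)
  · intro h p φ m hm
    choose m' hm' using hm
    have : m = c ∘ m' := funext fun i => (hm' i).symm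
    subst this
    have := h (φ.relabel (Sum.map id m'))
    simpa [Formula.realize_relabel, Sum.elim_comp_map] using this

theorem SameTypeOver.symm' {K : Type*} [L.Structure K] {A : Set K} {γ : Type*} {b b' : γ → K}
    (h : SameTypeOver L A b b') : SameTypeOver L A b' b :=
  fun p φ m hm => (h p φ m hm).symm

theorem SameTypeOver.trans' {K : Type*} [L.Structure K] {A : Set K} {γ : Type*}
    {b b' b'' : γ → K}
    (h : SameTypeOver L A b b') (h' : SameTypeOver L A b' b'') : SameTypeOver L A b b'' :=
  fun p φ m hm => (h p φ m hm).trans (h' p φ m hm)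

theorem SameTypeOver.comp' {K : Type*} [L.Structure K] {A : Set K} {γ γ' : Type*} {b b' : γ → K}
    (h : SameTypeOver L A b b') (g : γ' → γ) : SameTypeOver L A (b ∘ g) (b' ∘ g) := by
  intro p φ m hm
  have := h p (φ.relabel (Sum.map g id)) m hm
  simpa [Formula.realize_relabel, Sum.elim_comp_map] using this

theorem SameTypeOver.map' {K K' : Type*} [L.Structure K] [L.Structure K'] (f : K ↪ₑ[L] K')
    {A : Set K} {γ : Type*} {b b' : γ → K}
    (h : SameTypeOver L A b b') : SameTypeOver L (f '' A) (f ∘ b) (f ∘ b') := by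
  intro p φ m hm
  choose m' hm' using hm
  have : m = f ∘ m' := funext fun i => (hm' i).2.symm
  subst this
  rw [← Sum.comp_elim, ← Sum.comp_elim, f.map_formula, f.map_formula]
  exact h p φ m' fun i => (hm' i).1

/-- adding parameters to the tuples -/
theorem SameTypeOver.params {K : Type*} [L.Structure K] {P γ δ : Type*} {c : P → K}
    {b b' : γ → K} (h : SameTypeOver L (Set.range c) b b') (m : δ → P) :
    SameTypeOver L (Set.range c) (Sum.elim b (c ∘ m)) (Sum.elim b' (c ∘ m)) := by
  rw [sameTypeOver_range_iff] at h ⊢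
  intro φ
  have := h (φ.relabel (Sum.elim (Sum.map id m) Sum.inr))
  simp only [Formula.realize_relabel] at this
  have e : ∀ d : γ → K, Sum.elim d c ∘ Sum.elim (Sum.map id m) Sum.inr
      = Sum.elim (Sum.elim d (c ∘ m)) c := by
    intro d; ext ((x | x) | x) <;> rfl
  rwa [e, e] at this

/-- Finite families of formulas satisfied in an elementary extension are satisfied below. -/
theorem transfer {K K' : Type*} [L.Structure K] [L.Structure K'] (f : K ↪ₑ[L] K')
    {V ι : Type*} [Finite V] [Finite ι] (χ : ι → L.Formula (V ⊕ K)) (v : V → K')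
    (hv : ∀ i, (χ i).Realize (Sum.elim v f)) :
    ∃ v' : V → K, ∀ i, (χ i).Realize (Sum.elim v' id) := by
  let Ψ : L.Formula K := ((Formula.iInf χ).relabel (Sum.swap : V ⊕ K → K ⊕ V)).iExs V
  have h1 : Ψ.Realize (f ∘ id) := by
    rw [Formula.realize_iExs]
    refine ⟨v, ?_⟩
    rw [Formula.realize_relabel, Formula.realize_iInf]
    intro i
    convert hv i using 1
    ext (x | x) <;> rfl
  rw [f.map_formula, Formula.realize_iExs] at h1
  obtain ⟨v', hv'⟩ := h1
  rw [Formula.realize_relabel, Formula.realize_iInf] at hv'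
  refine ⟨v', fun i => ?_⟩
  convert hv' i using 1
  ext (x | x) <;> rfl

/-! ### Ultrapowers -/

noncomputable def diagUP {K : Type*} [L.Structure K] [Nonempty K] {I : Type*} (W : Ultrafilter I) :
    K ↪ₑ[L] ((W : Filter I).Product (fun _ => K)) where
  toFun x := ((fun _ => x : I → K) : (W : Filter I).Product (fun _ => K))
  map_formula' := by
    intro n φ x
    have := Ultraproduct.realize_formula_cast (L := L) (M := fun _ : I => K) (u := W) φ
      (fun i _ => x i)
    rw [Filter.eventually_const] at this
    exact this

def mkUP {K : Type*} {I : Type*} (W : Ultrafilter I) (x : I → K) :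
    (W : Filter I).Product (fun _ => K) :=
  (x : (W : Filter I).Product (fun _ => K))

theorem realize_UP {K : Type*} [L.Structure K] [Nonempty K] {I : Type*} (W : Ultrafilter I)
    {β γ : Type*} (φ : L.Formula (β ⊕ γ)) (x : β → I → K) (c : γ → K) :
    φ.Realize (Sum.elim (fun t => mkUP W (x t)) (diagUP (L := L) W ∘ c)) ↔
      ∀ᶠ s in W, φ.Realize (Sum.elim (fun t => x t s) c) := by
  have := Ultraproduct.realize_formula_cast (L := L) (M := fun _ : I => K) (u := W) φ
    (Sum.elim x (fun i _ => c i))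
  have e1 : Sum.elim (fun t => mkUP W (x t)) (diagUP (L := L) W ∘ c)
      = fun i => mkUP W ((Sum.elim x (fun i _ => c i) : β ⊕ γ → I → K) i) := by
    ext (t | t) <;> rfl
  have e2 : ∀ s, Sum.elim (fun t => x t s) c
      = fun i => (Sum.elim x (fun i _ => c i) : β ⊕ γ → I → K) i s := by
    intro s; ext (t | t) <;> rfl
  simp only [e2]
  rw [e1]
  exact this

theorem mkUP_const {K : Type*} [L.Structure K] [Nonempty K] {I : Type*} (W : Ultrafilter I)
    (x : K) : mkUP W (fun _ : I => x) = diagUP (L := L) W x := rfl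

/-! ### Iterated ultrafilter quantifiers -/

/-- iterated quantifier: the last coordinate is quantified outermost. -/
def IterQ {X : Type*} (U : Ultrafilter X) : (m : ℕ) → ((Fin m → X) → Prop) → Prop
  | 0, R => R Fin.elim0
  | m + 1, R => ∀ᶠ x in U, IterQ U m (fun t => R (Fin.snoc t x))

noncomputable def iterW {X : Type*} [Inhabited X] (U : Ultrafilter X) : ℕ → Ultrafilter (ℕ → X)
  | 0 => pure default
  | n + 1 => U.bind (fun x => (iterW U n).map (fun s => Function.update s n x))

noncomputable def limW {X : Type*} [Inhabited X] (U : Ultrafilter X) : Ultrafilter (ℕ → X) :=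
  (Filter.hyperfilter ℕ).bind (iterW U)

theorem eventually_ubind {X Y : Type*} (U : Ultrafilter X) (g : X → Ultrafilter Y) (R : Y → Prop) :
    (∀ᶠ y in U.bind g, R y) ↔ ∀ᶠ x in U, ∀ᶠ y in g x, R y := Iff.rfl

theorem iterW_iff {X : Type*} [Inhabited X] (U : Ultrafilter X) (n : ℕ) :
    ∀ (m : ℕ) (j : Fin m → ℕ) (_ : StrictMono j) (_ : ∀ k, j k < n) (R : (Fin m → X) → Prop),
      (∀ᶠ s in iterW U n, R (s ∘ j)) ↔ IterQ U m R := by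
  induction n with
  | zero =>
    intro m j hj hn R
    have : m = 0 := by
      rcases m with _ | m
      · rfl
      · exact absurd (hn 0) (by omega)
    subst this
    have e : ∀ s : ℕ → X, s ∘ j = Fin.elim0 := fun s => Subsingleton.elim _ _
    simp only [e, Filter.eventually_const]
    rfl
  | succ n ih =>
    intro m j hj hn R
    have h0 : (∀ᶠ s in iterW U (n+1), R (s ∘ j)) ↔
        ∀ᶠ x in U, ∀ᶠ s in iterW U n, R (Function.update s n x ∘ j) := Iff.rfl
    rw [h0]
    rcases m with _ | m
    · have e : ∀ s : ℕ → X, s ∘ j = Fin.elim0 := fun s => Subsingleton.elim _ _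
      simp only [e, Filter.eventually_const]
      rfl
    · by_cases hl : j (Fin.last m) = n
      · have e : ∀ (x : X) (s : ℕ → X), Function.update s n x ∘ j
            = Fin.snoc (s ∘ (j ∘ Fin.castSucc)) x := by
          intro x s
          ext k
          refine Fin.lastCases ?_ (fun k => ?_) k
          · simp [hl]
          · have : j k.castSucc < n := hl ▸ hj (Fin.castSucc_lt_last k)
            simp [Function.update_of_ne this.ne]
        simp only [e]
        have hj' : StrictMono (j ∘ Fin.castSucc) := hj.comp Fin.strictMono_castSucc
        have hn' : ∀ k, (j ∘ Fin.castSucc) k < n := fun k => hl ▸ hj (Fin.castSucc_lt_last k)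
        have := fun x => ih m (j ∘ Fin.castSucc) hj' hn' (fun t => R (Fin.snoc t x))
        simp only [this]
        rfl
      · have hn' : ∀ k, j k < n := by
          intro k
          have h1 := hn (Fin.last m)
          have h2 := hj.monotone (Fin.le_last k)
          omega
        have e : ∀ (x : X) (s : ℕ → X), Function.update s n x ∘ j = s ∘ j := by
          intro x s
          ext k
          simp [Function.update_of_ne (hn' k).ne]
        simp only [e, Filter.eventually_const]
        exact ih _ j hj hn' R

theorem limW_iff {X : Type*} [Inhabited X] (U : Ultrafilter X) 
    (m : ℕ) (j : Fin m → ℕ) (hj : StrictMono j) (R : (Fin m → X) → Prop) :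
      (∀ᶠ s in limW U, R (s ∘ j)) ↔ IterQ U m R := by
  have h0 : (∀ᶠ s in limW U, R (s ∘ j)) ↔
      ∀ᶠ n in (Filter.hyperfilter ℕ), ∀ᶠ s in iterW U n, R (s ∘ j) := Iff.rfl
  rw [h0]
  obtain ⟨N, hN⟩ : ∃ N, ∀ k, j k < N :=
    ⟨(Finset.univ.sup j) + 1, fun k => Nat.lt_succ_of_le (Finset.le_sup (Finset.mem_univ k))⟩
  have h1 : ∀ᶠ n in (Filter.hyperfilter ℕ : Filter ℕ),
      ((∀ᶠ s in iterW U n, R (s ∘ j)) ↔ IterQ U m R) := by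
    have : ∀ᶠ n in (Filter.hyperfilter ℕ : Filter ℕ), N ≤ n :=
      Nat.hyperfilter_le_atTop (Filter.eventually_ge_atTop N)
    filter_upwards [this] with n hn
    exact iterW_iff U n m j hj (fun k => (hN k).trans_le hn) R
  rw [Filter.eventually_congr h1, Filter.eventually_const]

theorem IterQ_cons {X : Type*} (U : Ultrafilter X) (m : ℕ) :
    ∀ R : (Fin (m + 1) → X) → Prop,
      IterQ U (m + 1) R ↔ IterQ U m (fun t => ∀ᶠ x in U, R (Fin.cons x t)) := by
  induction m with
  | zero =>
    intro R
    have e : ∀ x : X, (Fin.snoc (Fin.elim0 : Fin 0 → X) x : Fin 1 → X)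
        = Fin.cons x (Fin.elim0 : Fin 0 → X) := by
      intro x; ext k; fin_cases k; rfl
    simp only [IterQ, e]
  | succ m ih =>
    intro R
    show (∀ᶠ x in U, IterQ U (m+1) (fun t => R (Fin.snoc t x))) ↔
      ∀ᶠ y in U, IterQ U m (fun t => ∀ᶠ x in U, R (Fin.cons x (Fin.snoc t y : Fin (m+1) → X)))
    simp only [ih]
    have : ∀ (x y : X) (t : Fin m → X), (Fin.cons x (Fin.snoc t y : Fin (m+1) → X) : Fin (m+2) → X)
        = Fin.snoc (Fin.cons x t : Fin (m+1) → X) y := by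
      intro x y t
      exact Fin.cons_snoc_eq_snoc_cons x t y
    simp only [this]

/-- put `e` in front of a sequence -/
def consSeq {X : Type*} (e : X) (c : ℕ → X) : ℕ → X
  | 0 => e
  | n + 1 => c n

theorem limW_cons_iff {X Y : Type*} [Inhabited X] (U : Ultrafilter X) (ι : X → Y) (e : Y)
    (m : ℕ) (j : Fin m → ℕ) (hj : StrictMono j) (R : (Fin m → Y) → Prop)
    (hR : ∀ (m' : ℕ) (hm : m = m' + 1) (t : Fin m' → X),
      R ((Fin.cons e (ι ∘ t) : Fin (m' + 1) → Y) ∘ Fin.cast hm) ↔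
        ∀ᶠ x in U, R ((Fin.cons (ι x) (ι ∘ t) : Fin (m' + 1) → Y) ∘ Fin.cast hm)) :
      (∀ᶠ s in limW U, R (consSeq e (ι ∘ s) ∘ j)) ↔ IterQ U m (fun t => R (ι ∘ t)) := by
  rcases m with _ | m
  · have e : ∀ s : ℕ → X, consSeq e (ι ∘ s) ∘ j = ι ∘ Fin.elim0 :=
      fun s => Subsingleton.elim _ _
    simp only [e, Filter.eventually_const]
    rfl
  · by_cases h0 : j 0 = 0
    · have hpos : ∀ k : Fin m, 0 < j k.succ := fun k => h0 ▸ hj (Fin.succ_pos k)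
      have e : ∀ s : ℕ → X, consSeq e (ι ∘ s) ∘ j
          = Fin.cons e (ι ∘ (s ∘ (fun k : Fin m => j k.succ - 1))) := by
        intro s
        ext k
        refine Fin.cases ?_ (fun k => ?_) k
        · simp [h0, consSeq]
        · obtain ⟨i, hi⟩ : ∃ i, j k.succ = i + 1 := ⟨j k.succ - 1, by have := hpos k; omega⟩
          simp [hi, consSeq]
      simp only [e]
      have hj' : StrictMono (fun k : Fin m => j k.succ - 1) := by
        intro a b hab
        have h1 := hj (Fin.succ_lt_succ_iff.2 hab)
        have h2 := hpos a
        show j a.succ - 1 < j b.succ - 1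
        omega
      rw [limW_iff U m _ hj' (fun t => R (Fin.cons _ (ι ∘ t))), IterQ_cons]
      have e2 : ∀ (x : X) (t : Fin m → X), (ι ∘ (Fin.cons x t : Fin (m+1) → X))
          = (Fin.cons (ι x) (ι ∘ t) : Fin (m+1) → Y) := by
        intro x t
        ext k
        refine Fin.cases ?_ (fun k => ?_) k <;> simp
      simp only [e2]
      have := hR m rfl
      simp only [Fin.cast_refl, Function.comp_id] at this
      simp only [this]
    · have hpos : ∀ k, 0 < j k := by
        intro k
        have := hj.monotone (Fin.zero_le k)
        omega
      have e : ∀ s : ℕ → X, consSeq e (ι ∘ s) ∘ j = ι ∘ (s ∘ (fun k => j k - 1)) := by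
        intro s
        ext k
        obtain ⟨i, hi⟩ : ∃ i, j k = i + 1 := ⟨j k - 1, by have := hpos k; omega⟩
        simp [hi, consSeq]
      simp only [e]
      have hj' : StrictMono (fun k => j k - 1) := by
        intro a b hab
        have h1 := hj hab
        have h2 := hpos a
        show j a - 1 < j b - 1
        omega
      exact limW_iff U _ _ hj' (fun t => R (ι ∘ t))

/-! ### Coheir sequences -/

theorem exists_coheir {P K : Type*} [L.Structure P] [L.Structure K] (g : P ↪ₑ[L] K)
    {γ : Type*} [Finite γ] (e : γ → K) :
    ∃ U : Ultrafilter (γ → P), ∀ φ : L.Formula (γ ⊕ P),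
      φ.Realize (Sum.elim e g) ↔ ∀ᶠ x in U, φ.Realize (Sum.elim (g ∘ x) g) := by
  classical
  let S : L.Formula (γ ⊕ P) → Set (γ → P) := fun φ => {x | φ.Realize (Sum.elim (g ∘ x) g)}
  let T : Set (Set (γ → P)) := S '' {φ | φ.Realize (Sum.elim e g)}
  have hT : (Filter.generate T).NeBot := by
    rw [Filter.generate_neBot_iff]
    intro t ht hfin
    have : ∀ s : t, ∃ φ : L.Formula (γ ⊕ P), φ.Realize (Sum.elim e g) ∧ S φ = s := fun s => ht s.2
    choose φ hφ hS using this
    have := hfin.to_subtype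
    obtain ⟨x, hx⟩ := transfer g φ e hφ
    refine ⟨x, ?_⟩
    intro s hs
    have h1 := hx ⟨s, hs⟩
    rw [← g.map_formula, Sum.comp_elim] at h1
    have h2 := hS ⟨s, hs⟩
    simp only at h2
    rw [← h2]
    exact h1
  obtain ⟨U, hU⟩ := Ultrafilter.exists_le (Filter.generate T)
  have key : ∀ φ : L.Formula (γ ⊕ P), φ.Realize (Sum.elim e g) →
      ∀ᶠ x in U, φ.Realize (Sum.elim (g ∘ x) g) := by
    intro φ hφ
    exact hU (Filter.mem_generate_of_mem (Set.mem_image_of_mem S hφ))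
  refine ⟨U, fun φ => ⟨key φ, fun h => ?_⟩⟩
  by_contra hn
  have := key φ.not (by rwa [Formula.realize_not])
  obtain ⟨x, hx, hx'⟩ := (h.and this).exists
  rw [Formula.realize_not] at hx'
  exact hx' hx

theorem exists_common_seq {P : Type w} {K : Type (max u v w)} [L.Structure P] [L.Structure K]
    [Nonempty P] (g : P ↪ₑ[L] K) {γ : Type} [Finite γ] {ι : Type*} [Nonempty ι]
    (e : ι → γ → K)
    (he : ∀ i i', SameTypeOver L (Set.range g) (e i) (e i')) :
    ∃ (E : ElemExt L K) (c : ℕ → γ → E.Carrier), ∀ i,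
      IsIndiscernibleOver L (⇑E.emb '' Set.range g) (consSeq (⇑E.emb ∘ e i) c) := by
  classical
  obtain ⟨i0⟩ := ‹Nonempty ι›
  obtain ⟨U, hU⟩ := exists_coheir g (e i0)
  have hU' : ∀ i, ∀ φ : L.Formula (γ ⊕ P),
      φ.Realize (Sum.elim (e i) g) ↔ ∀ᶠ x in U, φ.Realize (Sum.elim (g ∘ x) g) := by
    intro i φ
    rw [← hU]
    exact (sameTypeOver_range_iff g _ _).1 (he i i0) φ
  have : Nonempty K := ‹Nonempty P›.map g
  have : Inhabited P := Classical.inhabited_of_nonempty ‹_›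
  let W := limW U
  let E : ElemExt L K := ⟨(W : Filter (ℕ → γ → P)).Product (fun _ => K), diagUP W⟩
  let c : ℕ → γ → E.Carrier := fun n t => mkUP W (fun s => g (s n t))
  refine ⟨E, c, fun i => ?_⟩
  have hd : ∀ n t, consSeq (⇑E.emb ∘ e i) c n t
      = mkUP W (fun s => consSeq (e i) ((fun x : γ → P => g ∘ x) ∘ s) n t) := by
    intro n t
    rcases n with _ | n
    · rfl
    · rfl
  have key : ∀ (m : ℕ) (j : Fin m → ℕ), StrictMono j → ∀ φ : L.Formula ((Fin m × γ) ⊕ P),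
      φ.Realize (Sum.elim (fun q : Fin m × γ => consSeq (⇑E.emb ∘ e i) c (j q.1) q.2)
        (⇑E.emb ∘ g)) ↔
      IterQ U m (fun t => φ.Realize (Sum.elim (fun q : Fin m × γ => g (t q.1 q.2)) g)) := by
    intro m j hj φ
    simp only [hd]
    refine (realize_UP W φ (fun (q : Fin m × γ) s =>
      consSeq (e i) ((fun x : γ → P => g ∘ x) ∘ s) (j q.1) q.2) g).trans ?_
    refine limW_cons_iff U (fun x : γ → P => g ∘ x) (e i) m j hj
      (fun y => φ.Realize (Sum.elim (fun q : Fin m × γ => y q.1 q.2) g)) ?_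
    intro m' hm t
    subst hm
    have h := hU' i (φ.relabel (Sum.elim
      (fun q : Fin (m' + 1) × γ => (Fin.cases (Sum.inl q.2) (fun k => Sum.inr (t k q.2)) q.1 :
        γ ⊕ P)) Sum.inr))
    simp only [Formula.realize_relabel] at h
    have e1 : ∀ y : γ → K, (Sum.elim y g ∘ Sum.elim
      (fun q : Fin (m' + 1) × γ => (Fin.cases (Sum.inl q.2) (fun k => Sum.inr (t k q.2)) q.1 :
        γ ⊕ P)) Sum.inr) = Sum.elim (fun q : Fin (m' + 1) × γ =>
          (Fin.cons y ((fun x : γ → P => (g ∘ x : γ → K)) ∘ t) : Fin (m'+1) → γ → K) q.1 q.2)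
          g := by
      intro y
      ext (⟨k, s⟩ | p)
      · refine Fin.cases ?_ (fun k => ?_) k <;> rfl
      · rfl
    simp only [e1] at h
    exact h
  intro m j j' hj hj'
  rw [← Set.range_comp, sameTypeOver_range_iff]
  intro φ
  rw [key m j hj, key m j' hj']

/-! ### NIP -/

theorem nip_alternation {N : Type w} [L.Structure N] (hNIP : IsNIP L N)
    {K : Type (max u v w)} [L.Structure K] [Nonempty K] (f : N ↪ₑ[L] K)
    {α : Type*} [Finite α] {t : ℕ} (φ : L.Formula (α ⊕ Fin t)) (d : ℕ → Fin t → K) (A : Set K)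
    (hd : IsIndiscernibleOver L A d)
    (h : ∀ n : ℕ, ∃ a : α → K, ∀ k < n, ¬ (φ.Realize (Sum.elim a (d (2 * k))) ↔
      φ.Realize (Sum.elim a (d (2 * k + 1))))) : False := by
  classical
  have sh : ∀ (n : ℕ) (S : Set ℕ), ∃ a : α → K, ∀ k < n,
      (φ.Realize (Sum.elim a (d k)) ↔ k ∈ S) := by
    intro n S
    obtain ⟨a, ha⟩ := h n
    have : ∀ k : Fin n, ∃ r : ℕ, 2 * (k:ℕ) ≤ r ∧ r ≤ 2 * (k:ℕ) + 1 ∧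
        (φ.Realize (Sum.elim a (d r)) ↔ (k:ℕ) ∈ S) := by
      intro k
      have h1 := ha k k.2
      by_cases h2 : φ.Realize (Sum.elim a (d (2 * k))) ↔ (k:ℕ) ∈ S
      · exact ⟨2 * k, le_rfl, by omega, h2⟩
      · exact ⟨2 * k + 1, by omega, le_rfl, by tauto⟩
    choose r hr1 hr2 hr3 using this
    have hr : StrictMono r := by
      intro x y hxy
      have := hr1 y; have := hr2 x
      have : (x:ℕ) < y := hxy
      omega
    let ψ : L.Formula ((Fin n × Fin t) ⊕ α) := Formula.iInf (fun k : Fin n =>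
      (if (k:ℕ) ∈ S then φ else φ.not).relabel (Sum.elim Sum.inr (fun s => Sum.inl (k, s))))
    have hψ : ∀ (i : Fin n → ℕ) (a : α → K),
        ψ.Realize (Sum.elim (fun q : Fin n × Fin t => d (i q.1) q.2) a) ↔
        ∀ k : Fin n, (φ.Realize (Sum.elim a (d (i k))) ↔ (k:ℕ) ∈ S) := by
      intro i a
      rw [Formula.realize_iInf]
      refine forall_congr' fun k => ?_
      rw [Formula.realize_relabel]
      have e : (Sum.elim (fun q : Fin n × Fin t => d (i q.1) q.2) a) ∘
          (Sum.elim Sum.inr (fun s => Sum.inl (k, s))) = Sum.elim a (d (i k)) := by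
        ext (x | x) <;> rfl
      rw [e]
      by_cases hk : (k:ℕ) ∈ S <;> simp [hk, Formula.realize_not]
    let Ψ := ψ.iExs α
    have h1 := hd n r (fun k => k) hr (fun x y hxy => hxy) 0
      (Ψ.relabel Sum.inl) Fin.elim0 (fun i => i.elim0)
    simp only [Formula.realize_relabel, Sum.elim_comp_inl] at h1
    rw [Formula.realize_iExs, Formula.realize_iExs] at h1
    obtain ⟨a', ha'⟩ := h1.1 ⟨a, (hψ r a).2 hr3⟩
    exact ⟨a', fun k hk => (hψ (fun k => k) a').1 ha' ⟨k, hk⟩⟩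
  choose x hx using sh
  let W := Filter.hyperfilter ℕ
  let K' := (W : Filter ℕ).Product (fun _ => K)
  have hmod : K' ⊨ L.completeTheory N :=
    (((diagUP W).comp f).theory_model_iff _).1 inferInstance
  obtain ⟨nx, ⟨eα⟩⟩ := Finite.exists_equiv_fin α
  refine hNIP t nx (φ.relabel (Sum.elim (Sum.inr ∘ eα) Sum.inl)) ⟨Theory.ModelType.mk K',
    fun i => diagUP (L := L) W ∘ d i, fun S s => mkUP W (fun n => x n S (eα.symm s)), ?_⟩
  intro i S
  rw [Formula.realize_relabel]
  have e : (Sum.elim (diagUP (L := L) W ∘ d i) (fun s => mkUP W (fun n => x n S (eα.symm s)))) ∘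
      (Sum.elim (Sum.inr ∘ eα) Sum.inl) =
      Sum.elim (fun s => mkUP W (fun n => x n S s)) (diagUP (L := L) W ∘ d i) := by
    ext (s | s)
    · simp
    · rfl
  refine (iff_of_eq (congrArg φ.Realize e)).trans ?_
  refine (realize_UP W φ (fun s n => x n S s) (d i)).trans ?_
  have : ∀ᶠ n in (W : Filter ℕ), i < n :=
    Nat.hyperfilter_le_atTop (Filter.eventually_gt_atTop i)
  rw [Filter.eventually_congr (q := fun _ => i ∈ S)
    (by filter_upwards [this] with n hn using hx n S i hn), Filter.eventually_const]

/-! ### Splitting implies forking -/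

theorem pair_indiscernible {K : Type*} [L.Structure K] {A : Set K} {t : ℕ} {d : ℕ → Fin t → K}
    (hd : IsIndiscernibleOver L A d) :
    IsIndiscernibleOver L A (fun k => Fin.append (d (2 * k)) (d (2 * k + 1))) := by
  intro m i j hi hj
  have aux : ∀ i : Fin m → ℕ, StrictMono i →
      StrictMono (fun q : Fin (2 * m) => 2 * i ⟨q / 2, by omega⟩ + (q : ℕ) % 2) := by
    intro i hi x y hxy
    have hxy' : (x : ℕ) < y := hxy
    show 2 * i ⟨x / 2, by omega⟩ + (x : ℕ) % 2 < 2 * i ⟨y / 2, by omega⟩ + (y : ℕ) % 2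
    rcases (show (x : ℕ) / 2 ≤ y / 2 by omega).lt_or_eq with h | h
    · have := hi (show (⟨x / 2, by omega⟩ : Fin m) < ⟨y / 2, by omega⟩ from h)
      omega
    · have : (⟨x / 2, by omega⟩ : Fin m) = ⟨y / 2, by omega⟩ := Fin.ext h
      rw [this]
      omega
  let G : Fin m × Fin (t + t) → Fin (2 * m) × Fin t := fun q =>
    Fin.addCases (fun s => (⟨2 * q.1, by omega⟩, s)) (fun s => (⟨2 * q.1 + 1, by omega⟩, s)) q.2
  have h := (hd (2 * m) _ _ (aux i hi) (aux j hj)).comp' G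
  have e : ∀ i : Fin m → ℕ, (fun q : Fin (2 * m) × Fin t =>
      d (2 * i ⟨q.1 / 2, by omega⟩ + (q.1 : ℕ) % 2) q.2) ∘ G =
      (fun q : Fin m × Fin (t + t) => Fin.append (d (2 * i q.1)) (d (2 * i q.1 + 1)) q.2) := by
    intro i
    ext ⟨k, s⟩
    refine Fin.addCases (fun s => ?_) (fun s => ?_) s
    · have h1 : 2 * (k : ℕ) / 2 = k := by omega
      have h2 : 2 * (k : ℕ) % 2 = 0 := by omega
      simp [G]
    · have h1 : (2 * (k : ℕ) + 1) / 2 = k := by omega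
      have h2 : (2 * (k : ℕ) + 1) % 2 = 1 := by omega
      have h3 : G (k, Fin.natAdd t s) = (⟨2 * k + 1, by omega⟩, s) := Fin.addCases_right _
      rw [Function.comp_apply, h3]
      simp only [h1, h2, Fin.eta, Fin.append_right]
  rw [e, e] at h
  exact h

theorem image_id_emb {K : Type*} [L.Structure K] (A : Set K) :
    ⇑(ElementaryEmbedding.refl L K) '' A = A := by
  ext x; simp

theorem forks_of_split {N : Type w} [L.Structure N] (hNIP : IsNIP L N)
    {K : Type (max u v w)} [L.Structure K] (f : N ↪ₑ[L] K)
    {P : Type w} [L.Structure P] [Nonempty P] (g : P ↪ₑ[L] K)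
    {α : Type*} [Finite α] {p t r : ℕ} (θ : L.Formula (α ⊕ Fin p)) (h : Fin p → K)
    (φ : L.Formula (α ⊕ Fin t)) (e : Fin (r + 1) → Fin t → K)
    (he : ∀ i i', SameTypeOver L (Set.range g) (e i) (e i'))
    (hθ : ∀ a : α → K, θ.Realize (Sum.elim a h) →
      ∃ i i', φ.Realize (Sum.elim a (e i)) ∧ ¬ φ.Realize (Sum.elim a (e i'))) :
    Forks L (Set.range g) θ h := by
  obtain ⟨E, c, hc⟩ := exists_common_seq g e he
  have : Nonempty E.Carrier := ‹Nonempty P›.map (E.emb ∘ g)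
  let φ1 : L.Formula (α ⊕ Fin (t + t)) := φ.relabel (Sum.map id (Fin.castAdd t))
  let φ2 : L.Formula (α ⊕ Fin (t + t)) := φ.relabel (Sum.map id (Fin.natAdd t))
  let ψ : L.Formula (α ⊕ Fin (t + t)) := (φ1.iff φ2).not
  have hψ : ∀ (a : α → E.Carrier) (y z : Fin t → E.Carrier),
      ψ.Realize (Sum.elim a (Fin.append y z)) ↔
      ¬ (φ.Realize (Sum.elim a y) ↔ φ.Realize (Sum.elim a z)) := by
    intro a y z
    have e1 : Fin.append y z ∘ Fin.castAdd t = y := by ext s; simp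
    have e2 : Fin.append y z ∘ Fin.natAdd t = z := by
      ext s; exact Fin.append_right y z s
    simp only [ψ, φ1, φ2, Formula.realize_not, Formula.realize_iff, Formula.realize_relabel,
      Sum.elim_comp_map, e1, e2, Function.comp_id]
  refine ⟨E, r + 1, t + t, fun _ => ψ, fun i => Fin.append (E.emb ∘ e i) (c 0), ?_, ?_⟩
  · intro i
    refine ⟨⟨E.Carrier, ElementaryEmbedding.refl L E.Carrier⟩,
      fun k => Fin.append (consSeq (E.emb ∘ e i) c (2 * k)) (consSeq (E.emb ∘ e i) c (2 * k + 1)),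
      ?_, ?_, ?_⟩
    · simp only [image_id_emb]
      exact pair_indiscernible (hc i)
    · intro p φ m hm
      exact Iff.rfl
    · intro hcon
      refine nip_alternation hNIP (E.emb.comp f) φ _ _ (hc i) (fun n => ?_)
      obtain ⟨a, ha⟩ := hcon (Finset.range n)
      exact ⟨a, fun k hk => (hψ _ _ _).1 (ha k (Finset.mem_range.2 hk))⟩
  · intro a ha
    by_contra hno
    push Not at hno
    simp only [hψ, not_not] at hno
    let χ : Option (Fin (r+1) × Fin (r+1)) → L.Formula (α ⊕ K) := fun o => match o with
      | none => θ.relabel (Sum.map id h)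
      | some (i, i') => (φ.relabel (Sum.map id (e i))).iff (φ.relabel (Sum.map id (e i')))
    obtain ⟨a', ha'⟩ := transfer E.emb χ a (by
      rintro (_ | ⟨i, i'⟩)
      · simpa [χ, Formula.realize_relabel, Sum.elim_comp_map] using ha
      · simp only [χ, Formula.realize_relabel, Sum.elim_comp_map, Formula.realize_iff,
          Function.comp_id]
        exact (hno i).trans (hno i').symm)
    have h0 := ha' none
    simp only [χ, Formula.realize_relabel, Sum.elim_comp_map, Function.comp_id,
      Function.id_comp] at h0
    obtain ⟨i, i', h1, h2⟩ := hθ a' h0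
    have h3 := ha' (some (i, i'))
    simp only [χ, Formula.realize_relabel, Sum.elim_comp_map, Function.comp_id,
      Function.id_comp, Formula.realize_iff] at h3
    exact h2 (h3.1 h1)

/-! ### Saturation -/

theorem sat_ext {N : Type w} [L.Structure N] {κ : Cardinal.{w}} (hsat : IsSaturated L κ N)
    {K : Type*} [L.Structure K] (f : N ↪ₑ[L] K)
    (A : Set N) (hA : Cardinal.mk A < κ) {V : Type} [Finite V] {ι : Type (max u v w)}
    (χ : ι → L.Formula (V ⊕ A))
    (hfin : ∀ s : Finset ι, ∃ x : V → K, ∀ i ∈ s, (χ i).Realize (Sum.elim x (f ∘ Subtype.val))) :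
    ∃ x : V → N, ∀ i, (χ i).Realize (Sum.elim x Subtype.val) := by
  obtain ⟨n, ⟨eV⟩⟩ := Finite.exists_equiv_fin V
  have hsup := fun i => fin_support.{u, v, w} ((χ i).relabel (Sum.map eV id))
  choose p φ m hm using hsup
  have hreal : ∀ (i : ι) (x : Fin n → N), (φ i).Realize (Sum.elim x (Subtype.val ∘ m i)) ↔
      (χ i).Realize (Sum.elim (x ∘ eV) Subtype.val) := by
    intro i x
    rw [hm, Formula.realize_relabel, Sum.elim_comp_map, Function.comp_id]
  obtain ⟨x, hx⟩ := hsat A hA n ι p φ (fun i => Subtype.val ∘ m i) (fun i j => (m i j).2) (by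
    intro s
    obtain ⟨x, hx⟩ := hfin s
    obtain ⟨x', hx'⟩ := transfer f (fun i : s => (χ i).relabel (Sum.map id (Subtype.val : A → N))) x
      (by
        intro i
        rw [Formula.realize_relabel, Sum.elim_comp_map, Function.comp_id]
        exact hx i i.2)
    refine ⟨x' ∘ eV.symm, fun i hi => ?_⟩
    have := hx' ⟨i, hi⟩
    rw [Formula.realize_relabel, Sum.elim_comp_map, Function.comp_id, Function.id_comp] at this
    rw [hreal]
    convert this using 2
    ext s; simp)
  exact ⟨x ∘ eV, fun i => (hreal i x).1 (hx i)⟩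

theorem sat_step {N : Type w} [L.Structure N] {κ : Cardinal.{w}} (hsat : IsSaturated L κ N)
    {K : Type*} [L.Structure K] (f : N ↪ₑ[L] K)
    (A : Set N) (hA : ∀ C : Set N, C.Countable → Cardinal.mk ↑(A ∪ C) < κ)
    (v : ℕ → K) (n : ℕ) (g : ℕ → N)
    (hg : ∀ φ : L.Formula (Fin n ⊕ A),
      φ.Realize (Sum.elim (fun k => v k) (f ∘ Subtype.val)) ↔
      φ.Realize (Sum.elim (fun k => g k) Subtype.val)) :
    ∃ a : N, ∀ φ : L.Formula (Fin (n + 1) ⊕ A),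
      φ.Realize (Sum.elim (fun k => v k) (f ∘ Subtype.val)) ↔
      φ.Realize (Sum.elim (fun k => Function.update g n a k) Subtype.val) := by
  classical
  let A' : Set N := A ∪ Set.range (fun k : Fin n => g k)
  have hA' : Cardinal.mk A' < κ := hA _ (Set.countable_range _)
  let ι := {φ : L.Formula (Fin (n + 1) ⊕ A) //
    φ.Realize (Sum.elim (fun k => v k) (f ∘ Subtype.val))}
  let ρ : Fin (n + 1) ⊕ A → Unit ⊕ A' := Sum.elim
    (Fin.lastCases (Sum.inl ()) (fun k => Sum.inr ⟨g k, Or.inr ⟨k, rfl⟩⟩))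
    (fun a => Sum.inr ⟨a, Or.inl a.2⟩)
  have hρ : ∀ y : Unit → N, Sum.elim y (Subtype.val : A' → N) ∘ ρ
      = Sum.elim (fun k : Fin (n + 1) => Function.update g n (y ()) k) Subtype.val := by
    intro y
    ext (k | a)
    · refine Fin.lastCases ?_ (fun k => ?_) k
      · simp [ρ]
      · simp [ρ, Function.update_of_ne k.2.ne]
    · rfl
  obtain ⟨y, hy⟩ := sat_ext hsat (ElementaryEmbedding.refl L N) A' hA'
    (fun i : ι => i.1.relabel ρ) (by
      intro s
      let σ : Fin (n + 1) ⊕ A → (Fin n ⊕ A) ⊕ Unit := Sum.elim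
        (Fin.lastCases (Sum.inr ()) (fun k => Sum.inl (Sum.inl k))) (fun a => Sum.inl (Sum.inr a))
      let Φ : L.Formula (Fin (n + 1) ⊕ A) := Formula.iInf (fun i : s => i.1.1)
      have h1 : ((Φ.relabel σ).iExs Unit).Realize (Sum.elim (fun k : Fin n => v k)
          (f ∘ Subtype.val)) := by
        rw [Formula.realize_iExs]
        refine ⟨fun _ => v n, ?_⟩
        rw [Formula.realize_relabel, Formula.realize_iInf]
        intro i
        convert i.1.2 using 1
        ext (k | a)
        · refine Fin.lastCases ?_ (fun k => ?_) k <;> simp [σ]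
        · rfl
      rw [hg, Formula.realize_iExs] at h1
      obtain ⟨y, hy⟩ := h1
      rw [Formula.realize_relabel, Formula.realize_iInf] at hy
      refine ⟨y, fun i hi => ?_⟩
      have := hy ⟨i, hi⟩
      rw [Formula.realize_relabel]
      convert this using 1
      refine (hρ y).trans ?_
      ext (k | a)
      · refine Fin.lastCases ?_ (fun k => ?_) k
        · simp [σ]
        · simp [σ, Function.update_of_ne k.2.ne]
      · rfl)
  refine ⟨y (), ?_⟩
  have key : ∀ φ : L.Formula (Fin (n + 1) ⊕ A),
      φ.Realize (Sum.elim (fun k => v k) (f ∘ Subtype.val)) →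
      φ.Realize (Sum.elim (fun k => Function.update g n (y ()) k) Subtype.val) := by
    intro φ hφ
    have := hy ⟨φ, hφ⟩
    rwa [Formula.realize_relabel, hρ] at this
  intro φ
  refine ⟨key φ, fun h => ?_⟩
  by_contra hn
  have := key φ.not (by rwa [Formula.realize_not])
  rw [Formula.realize_not] at this
  exact this h

theorem sat_seq {N : Type w} [L.Structure N] [Nonempty N] {κ : Cardinal.{w}}
    (hsat : IsSaturated L κ N)
    {K : Type w} [L.Structure K] (f : N ↪ₑ[L] K)
    (A : Set N) (hA : ∀ C : Set N, C.Countable → Cardinal.mk ↑(A ∪ C) < κ)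
    (v : ℕ → K) :
    ∃ g : ℕ → N, ∀ φ : L.Formula (A ⊕ ℕ),
      φ.Realize (Sum.elim (f ∘ Subtype.val) v) ↔ φ.Realize (Sum.elim Subtype.val g) := by
  classical
  let Good : ℕ → (ℕ → N) → Prop := fun n g => ∀ φ : L.Formula (Fin n ⊕ A),
      φ.Realize (Sum.elim (fun k => v k) (f ∘ Subtype.val)) ↔
      φ.Realize (Sum.elim (fun k => g k) Subtype.val)
  have h0 : Good 0 (fun _ => Classical.arbitrary N) := by
    intro φ
    rw [← f.map_formula, Sum.comp_elim]
    have : (fun k : Fin 0 => v k) = f ∘ (fun k : Fin 0 => Classical.arbitrary N) :=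
      Subsingleton.elim _ _
    rw [this]
  have hstep : ∀ n (g : {g // Good n g}), ∃ a, Good (n + 1) (Function.update g.1 n a) :=
    fun n g => sat_step hsat f A hA v n g.1 g.2
  choose a ha using hstep
  let G : ∀ n, {g // Good n g} := fun n =>
    Nat.rec (motive := fun n => {g // Good n g}) ⟨fun _ => Classical.arbitrary N, h0⟩ (fun n g => ⟨_, ha n g⟩) n
  have hG : ∀ n, (G (n + 1)).1 = Function.update (G n).1 n (a n (G n)) := fun n => rfl
  let g : ℕ → N := fun n => (G (n + 1)).1 n
  have hg : ∀ n k, k < n → (G n).1 k = g k := by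
    intro n
    induction n with
    | zero => intro k hk; omega
    | succ n ih =>
      intro k hk
      rcases (Nat.lt_succ_iff.1 hk).lt_or_eq with h | h
      · rw [hG, Function.update_of_ne h.ne, ih k h]
      · subst h; rfl
  refine ⟨g, fun φ => ?_⟩
  obtain ⟨p, φ', m, hm1⟩ := fin_support.{u, v, w} φ
  rw [← hm1, ← hm1]
  obtain ⟨n, hn⟩ : ∃ n, ∀ k, m k < n :=
    ⟨(Finset.univ.sup m) + 1, fun k => Nat.lt_succ_of_le (Finset.le_sup (Finset.mem_univ k))⟩
  have := (G n).2 (φ'.relabel (Sum.elim Sum.inr (fun k => Sum.inl ⟨m k, hn k⟩)))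
  rw [Formula.realize_relabel, Formula.realize_relabel] at this
  convert this using 2
  · ext (x | x) <;> rfl
  · ext (x | x)
    · rfl
    · exact (hg n _ (hn x)).symm

theorem small_union {N : Type w} [L.Structure N] (M : L.ElementarySubstructure N)
    (C : Set N) (hC : C.Countable) :
    Cardinal.mk ↑((M : Set N) ∪ C) < Order.succ (Cardinal.mk M) := by
  rw [Order.lt_succ_iff]
  rcases finite_or_infinite M with h | h
  · have hN : Cardinal.mk N ≤ Cardinal.mk M := by
      obtain ⟨k, hk⟩ := Cardinal.lt_aleph0.1 (Cardinal.mk_lt_aleph0 (α := M))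
      rw [hk]
      by_contra hlt
      push Not at hlt
      have h1 : ((k + 1 : ℕ) : Cardinal) ≤ Cardinal.mk N := by
        rw [Nat.cast_succ, ← Cardinal.succ_natCast]
        exact Order.succ_le_of_lt hlt
      rw [← Sentence.realize_cardGe (L := L), ← M.realize_sentence, Sentence.realize_cardGe,
        hk] at h1
      exact absurd (Nat.cast_le.1 h1) (by omega)
    exact (Cardinal.mk_set_le _).trans hN
  · refine (Cardinal.mk_union_le _ _).trans ?_
    have h1 : Cardinal.mk C ≤ Cardinal.mk M :=
      (Cardinal.le_aleph0_iff_set_countable.2 hC).trans (Cardinal.aleph0_le_mk M)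
    exact (Cardinal.add_le_of_le (Cardinal.aleph0_le_mk M) le_rfl h1)

/-! ### The two extension steps -/

theorem sameType_of_imp {K : Type*} [L.Structure K] {P γ : Type*} {c : P → K} {A : Set K}
    (hA : A = Set.range c) {b b' : γ → K}
    (h : ∀ φ : L.Formula (γ ⊕ P), φ.Realize (Sum.elim b c) → φ.Realize (Sum.elim b' c)) :
    SameTypeOver L A b b' := by
  rw [hA, sameTypeOver_range_iff]
  intro φ
  refine ⟨h φ, fun h' => ?_⟩
  by_contra hn
  have := h φ.not (by rwa [Formula.realize_not])
  rw [Formula.realize_not] at this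
  exact this h'

theorem range_val_M {N : Type w} [L.Structure N] (M : L.ElementarySubstructure N) :
    (M : Set N) = Set.range (Subtype.val : M → N) := Subtype.range_coe.symm

theorem range_comp_M {N : Type w} [L.Structure N] (M : L.ElementarySubstructure N)
    {K : Type*} [L.Structure K] (f : N ↪ₑ[L] K) :
    ⇑f '' (M : Set N) = Set.range (f.comp M.subtype) := by
  rw [range_val_M M, ← Set.range_comp]; rfl

theorem invariance_aux {N : Type w} [L.Structure N] [Nonempty N] (hNIP : IsNIP L N)
    (M : L.ElementarySubstructure N) {K : Type (max u v w)} [L.Structure K] (f : N ↪ₑ[L] K)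
    {R : Set K} (hR : ∀ x, f x ∈ R) {α : Type} [Finite α] (a' : α → K)
    (hnf : TypeDoesNotForkOver L (⇑f '' (M : Set N)) R a')
    {t : ℕ} (φ : L.Formula (α ⊕ Fin t)) (c c' : Fin t → N)
    (hc : SameTypeOver L (M : Set N) c c')
    (h : φ.Realize (Sum.elim a' (f ∘ c))) : φ.Realize (Sum.elim a' (f ∘ c')) := by
  by_contra hn
  let θ : L.Formula (α ⊕ Fin (t + t)) :=
    (φ.relabel (Sum.map id (Fin.castAdd t))) ⊓ (φ.relabel (Sum.map id (Fin.natAdd t))).not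
  have hθ : ∀ a : α → K, θ.Realize (Sum.elim a (Fin.append (f ∘ c) (f ∘ c'))) ↔
      φ.Realize (Sum.elim a (f ∘ c)) ∧ ¬ φ.Realize (Sum.elim a (f ∘ c')) := by
    intro a
    have e1 : Fin.append (f ∘ c) (f ∘ c') ∘ Fin.castAdd t = f ∘ c := by ext; simp
    have e2 : Fin.append (f ∘ c) (f ∘ c') ∘ Fin.natAdd t = f ∘ c' :=
      funext fun i => Fin.append_right _ _ i
    simp only [θ, Formula.realize_inf, Formula.realize_not, Formula.realize_relabel,
      Sum.elim_comp_map, e1, e2, Function.comp_id]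
  refine hnf (t + t) θ (Fin.append (f ∘ c) (f ∘ c')) ?_ ((hθ a').2 ⟨h, hn⟩) ?_
  · intro i
    refine Fin.addCases (fun i => ?_) (fun i => ?_) i
    · rw [Fin.append_left]; exact hR _
    · rw [Fin.append_right]; exact hR _
  · have hcc := hc.map' f
    rw [range_comp_M] at hcc ⊢
    refine forks_of_split hNIP f (f.comp M.subtype) θ _ φ (r := 1) ![f ∘ c, f ∘ c'] ?_ ?_
    · intro i i'
      fin_cases i <;> fin_cases i'
      · exact hcc.trans' hcc.symm'
      · exact hcc
      · exact hcc.symm'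
      · exact hcc.symm'.trans' hcc
    · intro a ha
      rw [hθ] at ha
      exact ⟨0, 1, ha.1, ha.2⟩

theorem invariance {N : Type w} [L.Structure N] [Nonempty N] (hNIP : IsNIP L N)
    (M : L.ElementarySubstructure N) {K : Type (max u v w)} [L.Structure K] (f : N ↪ₑ[L] K)
    {R : Set K} (hR : ∀ x, f x ∈ R) {α : Type} [Finite α] (a' : α → K)
    (hnf : TypeDoesNotForkOver L (⇑f '' (M : Set N)) R a')
    {T : Type*} (φ : L.Formula (α ⊕ (T ⊕ M))) (c c' : T → N)
    (hc : SameTypeOver L (M : Set N) c c')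
    (h : φ.Realize (Sum.elim a' (f ∘ Sum.elim c Subtype.val))) :
    φ.Realize (Sum.elim a' (f ∘ Sum.elim c' Subtype.val)) := by
  obtain ⟨p, φ', m, hm⟩ := fin_support.{u, v, max u v w} φ
  rw [← hm] at h ⊢
  refine invariance_aux hNIP M f hR a' hnf φ' (Sum.elim c Subtype.val ∘ m)
    (Sum.elim c' Subtype.val ∘ m) ?_ h
  rw [range_val_M] at hc ⊢
  exact (hc.params id).comp' m

theorem step_two {N : Type w} [L.Structure N] [Nonempty N] (hNIP : IsNIP L N)
    (M : L.ElementarySubstructure N) (hsat : IsSaturated L (Order.succ (Cardinal.mk M)) N)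
    {ny j : ℕ} {T : Type} [Finite T] (b : T → N) (y0 : Fin ny → N)
    (hs : StrictlyNonForkingOver L (M : Set N) y0 b) (e : Fin j → T → N)
    (he : ∀ i, SameTypeOver L (M : Set N) (e i) b) :
    ∃ y : Fin ny → N, ∀ i,
      SameTypeOver L (M : Set N) (Sum.elim (e i) y) (Sum.elim b y0) := by
  obtain ⟨E, F, a', h1, h2, -⟩ := hs
  let f : N ↪ₑ[L] F.Carrier := F.emb.comp E.emb
  have h2' : TypeDoesNotForkOver L (⇑f '' (M : Set N)) (Set.range F.emb) a' := h2
  have hR : ∀ x, f x ∈ Set.range F.emb := fun x => ⟨E.emb x, rfl⟩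
  have h1' : SameTypeOver L (Set.range (f ∘ Sum.elim b (Subtype.val : M → N))) a' (f ∘ y0) := by
    convert h1 using 1
    · rw [Set.range_comp, Set.Sum.elim_range, Set.union_comm]
      congr 2
      exact Subtype.range_coe
    · rfl
  let A : Set N := M ∪ Set.range (Function.uncurry e)
  let ι := Fin j × {χ : L.Formula (Fin ny ⊕ (T ⊕ M)) //
    χ.Realize (Sum.elim y0 (Sum.elim b Subtype.val))}
  let ρ : Fin j → T ⊕ M → A := fun i =>
    Sum.elim (fun t => ⟨e i t, Or.inr ⟨(i, t), rfl⟩⟩) (fun m => ⟨m, Or.inl m.2⟩)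
  have hρ : ∀ i, Subtype.val ∘ ρ i = Sum.elim (e i) Subtype.val := by
    intro i; ext (t | m) <;> rfl
  obtain ⟨y, hy⟩ := sat_ext hsat f A (small_union M _ (Set.countable_range _))
    (fun i : ι => i.2.1.relabel (Sum.map id (ρ i.1))) (by
      intro s
      refine ⟨a', fun i _ => ?_⟩
      rw [Formula.realize_relabel, Sum.elim_comp_map, Function.comp_id, Function.comp_assoc, hρ]
      refine invariance hNIP M f hR a' h2' i.2.1 b (e i.1) (he i.1).symm' ?_
      rw [(sameTypeOver_range_iff _ _ _).1 h1', ← Sum.comp_elim, f.map_formula]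
      exact i.2.2)
  refine ⟨y, fun i => SameTypeOver.symm' ?_⟩
  refine sameType_of_imp (range_val_M M) fun φ hφ => ?_
  let σ : (T ⊕ Fin ny) ⊕ M → Fin ny ⊕ (T ⊕ M) :=
    Sum.elim (Sum.elim (fun t => Sum.inr (Sum.inl t)) Sum.inl) (fun m => Sum.inr (Sum.inr m))
  have hσ : ∀ (x : T → N) (y : Fin ny → N), Sum.elim y (Sum.elim x (Subtype.val : M → N)) ∘ σ
      = Sum.elim (Sum.elim x y) Subtype.val := by
    intro x y; ext ((t | t) | t) <;> rfl
  have := hy (i, ⟨φ.relabel σ, by rwa [Formula.realize_relabel, hσ]⟩)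
  rwa [Formula.realize_relabel, Sum.elim_comp_map, Function.comp_id, hρ,
    Formula.realize_relabel, hσ] at this

theorem step_one {N : Type w} [L.Structure N] [Nonempty N] (hNIP : IsNIP L N)
    (M : L.ElementarySubstructure N) (hsat : IsSaturated L (Order.succ (Cardinal.mk M)) N)
    {ny j : ℕ} {T : Type} [Finite T] (b : T → N) (y0 : Fin ny → N)
    (hs : StrictlyNonForkingOver L (M : Set N) y0 b) (B : Fin j → Fin ny → N)
    (hB : ∀ i, SameTypeOver L (M : Set N) (B i) y0) :
    ∃ x : T → N, ∀ i,
      SameTypeOver L (M : Set N) (Sum.elim x (B i)) (Sum.elim b y0) := by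
  classical
  obtain ⟨E, F, a', h1, -, h3⟩ := hs
  let f : N ↪ₑ[L] F.Carrier := F.emb.comp E.emb
  let g : M ↪ₑ[L] F.Carrier := f.comp M.subtype
  have h3' : TypeDoesNotForkOver L (⇑f '' (M : Set N)) (⇑f '' (M : Set N) ∪ Set.range a')
    (f ∘ b) := h3
  have h1' : SameTypeOver L (Set.range (f ∘ Sum.elim b (Subtype.val : M → N))) a' (f ∘ y0) := by
    convert h1 using 1
    · rw [Set.range_comp, Set.Sum.elim_range, Set.union_comm]
      congr 2
      exact Subtype.range_coe
    · rfl
  have h1M : SameTypeOver L (Set.range g) a' (f ∘ y0) := by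
    intro p φ m hm
    refine h1' p φ m fun i => ?_
    obtain ⟨x, hx⟩ := hm i
    exact ⟨Sum.inr x, hx⟩
  have hBM : ∀ i, SameTypeOver L (Set.range g) (f ∘ B i) a' := by
    intro i
    refine SameTypeOver.trans' ?_ h1M.symm'
    have := (hB i).map' f
    rwa [range_comp_M] at this
  let A : Set N := M ∪ Set.range (Function.uncurry B)
  let ι := Fin j × {χ : L.Formula (T ⊕ (Fin ny ⊕ M)) //
    χ.Realize (Sum.elim b (Sum.elim y0 Subtype.val))}
  let ρ : Fin j → Fin ny ⊕ M → A := fun i =>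
    Sum.elim (fun t => ⟨B i t, Or.inr ⟨(i, t), rfl⟩⟩) (fun m => ⟨m, Or.inl m.2⟩)
  have hρ : ∀ i, Subtype.val ∘ ρ i = Sum.elim (B i) Subtype.val := by
    intro i; ext (t | m) <;> rfl
  let σ' : T ⊕ (Fin ny ⊕ M) → Fin ny ⊕ (T ⊕ M) :=
    Sum.elim (fun t => Sum.inr (Sum.inl t)) (Sum.elim Sum.inl (fun m => Sum.inr (Sum.inr m)))
  have hσ' : ∀ (x : Fin ny → F.Carrier),
      Sum.elim x (f ∘ Sum.elim b (Subtype.val : M → N)) ∘ σ' = Sum.elim (f ∘ b) (Sum.elim x g) := by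
    intro x; ext (t | t | t) <;> rfl
  obtain ⟨x, hx⟩ := sat_ext hsat f A (small_union M _ (Set.countable_range _))
    (fun i : ι => i.2.1.relabel (Sum.map id (ρ i.1))) (by
      intro s
      let Φ : L.Formula (T ⊕ (Fin ny ⊕ M)) := Formula.iInf (fun i : s => i.1.2.1)
      have hΦ : Φ.Realize (Sum.elim (f ∘ b) (Sum.elim a' g)) := by
        have := (sameTypeOver_range_iff _ _ _).1 h1' (Φ.relabel σ')
        rw [Formula.realize_relabel, Formula.realize_relabel, hσ', hσ'] at this
        rw [this]
        have e : Sum.elim (f ∘ b) (Sum.elim (f ∘ y0) g)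
            = f ∘ Sum.elim b (Sum.elim y0 (Subtype.val : M → N)) := by
          ext (t | t | t) <;> rfl
        rw [e, f.map_formula, Formula.realize_iInf]
        exact fun i => i.1.2.2
      obtain ⟨p, φ', m, hm⟩ := fin_support.{u, v, max u v w} Φ
      have hnf : ¬ Forks L (Set.range g) φ' (Sum.elim a' g ∘ m) := by
        rw [← range_comp_M]
        refine h3' p φ' _ ?_ ((hm _ _ _).2 hΦ)
        intro i
        rw [Function.comp_apply]
        rcases m i with t | t
        · exact Or.inr ⟨t, rfl⟩
        · exact Or.inl ⟨t, t.2, rfl⟩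
      have key : ∃ x : T → F.Carrier, ∀ i, Φ.Realize (Sum.elim x (Sum.elim (f ∘ B i) g)) := by
        by_contra hcon
        push Not at hcon
        refine hnf (forks_of_split hNIP f g φ' _ φ' (r := j)
          (Fin.cons (Sum.elim a' g ∘ m) (fun i => Sum.elim (f ∘ B i) g ∘ m)) ?_ ?_)
        · have : ∀ i, SameTypeOver L (Set.range g) ((Fin.cons (Sum.elim a' g ∘ m)
              (fun i => Sum.elim (f ∘ B i) g ∘ m) : Fin (j + 1) → Fin p → F.Carrier) i)
              (Sum.elim a' g ∘ m) := by
            intro i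
            refine Fin.cases ?_ (fun i => ?_) i
            · exact fun _ _ _ _ => Iff.rfl
            · exact ((hBM i).params id).comp' m
          exact fun i i' => (this i).trans' (this i').symm'
        · intro a ha
          obtain ⟨i, hi⟩ := hcon a
          refine ⟨0, i.succ, ha, ?_⟩
          rw [Fin.cons_succ, hm]
          exact hi
      obtain ⟨x, hx⟩ := key
      refine ⟨x, fun i hi => ?_⟩
      rw [Formula.realize_relabel, Sum.elim_comp_map, Function.comp_id, Function.comp_assoc, hρ,
        Sum.comp_elim]
      have := hx i.1
      rw [Formula.realize_iInf] at this
      exact this ⟨i, hi⟩)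
  refine ⟨x, fun i => SameTypeOver.symm' ?_⟩
  refine sameType_of_imp (range_val_M M) fun φ hφ => ?_
  let σ : (T ⊕ Fin ny) ⊕ M → T ⊕ (Fin ny ⊕ M) :=
    Sum.elim (Sum.elim Sum.inl (fun t => Sum.inr (Sum.inl t))) (fun m => Sum.inr (Sum.inr m))
  have hσ : ∀ (x : T → N) (y : Fin ny → N), Sum.elim x (Sum.elim y (Subtype.val : M → N)) ∘ σ
      = Sum.elim (Sum.elim x y) Subtype.val := by
    intro x y; ext ((t | t) | t) <;> rfl
  have := hx (i, ⟨φ.relabel σ, by rwa [Formula.realize_relabel, hσ]⟩)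
  rwa [Formula.realize_relabel, Sum.elim_comp_map, Function.comp_id, hρ,
    Formula.realize_relabel, hσ] at this

/-! ### Finite windows and the final assembly -/

theorem SameTypeOver.congr' {K : Type*} [L.Structure K] {A : Set K} {γ : Type*}
    {b b' c c' : γ → K} (h : SameTypeOver L A b b') (h1 : ∀ x, b x = c x) (h2 : ∀ x, b' x = c' x) :
    SameTypeOver L A c c' := by
  obtain rfl : b = c := funext h1
  obtain rfl : b' = c' := funext h2
  exact h

theorem window {N : Type w} [L.Structure N] [Nonempty N] (hNIP : IsNIP L N)
    (M : L.ElementarySubstructure N) (hsat : IsSaturated L (Order.succ (Cardinal.mk M)) N)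
    {ny : ℕ} (q : Fin ny → N) (b : ℕ → Fin ny → N)
    (hb : IsStrictMorleySequence L (M : Set N) q b)
    {j : ℕ} (B : Fin j → Fin ny → N)
    (hB : ∀ i, SameTypeOver L (M : Set N) (B i) q) (n k : ℕ) :
    ∃ g : ℕ → Fin ny → N, ∀ i, SameTypeOver L (M : Set N)
      (fun p : Fin (n + k + 1) × Fin ny => Function.update g n (B i) p.1 p.2)
      (fun p : Fin (n + k + 1) × Fin ny => b p.1 p.2) := by
  classical
  let ρ : ∀ n : ℕ, Fin (n + 1) × Fin ny → (Fin n × Fin ny) ⊕ Fin ny := fun n p =>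
    if h : (p.1 : ℕ) < n then Sum.inl (⟨p.1, h⟩, p.2) else Sum.inr p.2
  induction k with
  | zero =>
    rcases n with _ | n
    · refine ⟨fun _ _ => Classical.arbitrary N, fun i => ?_⟩
      refine (((hB i).trans' (hb.2.1 0).symm').comp'
        (Prod.snd : Fin (0 + 0 + 1) × Fin ny → Fin ny)).congr' ?_ ?_
      · rintro ⟨p, s⟩
        have : (p : ℕ) = 0 := by omega
        simp [this]
      · rintro ⟨p, s⟩
        have : (p : ℕ) = 0 := by omega
        simp [this]
    · obtain ⟨x, hx⟩ := step_one hNIP M hsat _ _ (hb.2.2 n) B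
        (fun i => (hB i).trans' (hb.2.1 (n + 1)).symm')
      refine ⟨fun k => if h : k < n + 1 then fun s => x (⟨k, h⟩, s) else
        fun _ => Classical.arbitrary N, fun i => ?_⟩
      refine ((hx i).comp' (ρ (n + 1))).congr' ?_ ?_
      · rintro ⟨p, s⟩
        by_cases h : (p : ℕ) < n + 1
        · simp [ρ, Nat.lt_succ_iff.1 h, Function.update_of_ne h.ne]
        · have : (p : ℕ) = n + 1 := by omega
          simp [ρ, this]
      · rintro ⟨p, s⟩
        by_cases h : (p : ℕ) < n + 1
        · simp [ρ, Nat.lt_succ_iff.1 h]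
        · have : (p : ℕ) = n + 1 := by omega
          simp [ρ, this]
  | succ k ih =>
    obtain ⟨g, hg⟩ := ih
    obtain ⟨y, hy⟩ := step_two hNIP M hsat _ _ (hb.2.2 (n + k)) _ hg
    refine ⟨Function.update g (n + k + 1) y, fun i => ?_⟩
    refine ((hy i).comp' (ρ (n + k + 1))).congr' ?_ ?_
    · rintro ⟨p, s⟩
      by_cases h : (p : ℕ) < n + k + 1
      · rw [Function.update_comm (by omega), Function.update_of_ne h.ne]
        simp [ρ, Nat.lt_succ_iff.1 h]
      · have : (p : ℕ) = n + k + 1 := by omega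
        rw [Function.update_comm (by omega)]
        simp [ρ, this]
    · rintro ⟨p, s⟩
      by_cases h : (p : ℕ) < n + k + 1
      · simp [ρ, Nat.lt_succ_iff.1 h]
      · have : (p : ℕ) = n + k + 1 := by omega
        simp [ρ, this]

theorem insertAtZero_eq {X γ : Type*} (d : γ → X) (g : ℕ → γ → X) (n : ℕ) (z : ℤ)
    (hz : 0 ≤ z + n) :
    insertAtZero d (fun t : {i : ℤ // i ≠ 0} => g ((t : ℤ) + n).toNat) z
      = Function.update g n d (z + n).toNat := by
  unfold insertAtZero
  by_cases h : z = 0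
  · simp [h]
  · rw [dif_neg h, Function.update_of_ne]
    omega

theorem exists_seq {N : Type w} [L.Structure N] [Nonempty N] (hNIP : IsNIP L N)
    (M : L.ElementarySubstructure N) (hsat : IsSaturated L (Order.succ (Cardinal.mk M)) N)
    {ny : ℕ} (q : Fin ny → N) (b : ℕ → Fin ny → N)
    (hb : IsStrictMorleySequence L (M : Set N) q b)
    {j : ℕ} (B : Fin j → Fin ny → N)
    (hB : ∀ i, SameTypeOver L (M : Set N) (B i) q) :
    ∃ d : {i : ℤ // i ≠ 0} → Fin ny → N, ∀ (i : Fin j) (n₀ : ℕ),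
      SameTypeOver L (M : Set N)
        (fun p : Fin (n₀ + n₀ + 1) × Fin ny => insertAtZero (B i) d ((p.1 : ℕ) - (n₀ : ℤ)) p.2)
        (fun p : Fin (n₀ + n₀ + 1) × Fin ny => b p.1 p.2) := by
  classical
  choose G hG using fun n => window hNIP M hsat q b hb B hB n n
  let W : Ultrafilter ℕ := Filter.hyperfilter ℕ
  let f := diagUP (L := L) (K := N) W
  let d' : {i : ℤ // i ≠ 0} → Fin ny → ℕ → N := fun t s n => G n ((t : ℤ) + n).toNat s
  have key : ∀ (i : Fin j) (n₀ : ℕ) (φ : L.Formula ((Fin (n₀ + n₀ + 1) × Fin ny) ⊕ M)),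
      φ.Realize (Sum.elim (fun p => b p.1 p.2) Subtype.val) →
      φ.Realize (Sum.elim (fun p => insertAtZero (f ∘ B i) (fun t s => mkUP W (d' t s))
        ((p.1 : ℕ) - (n₀ : ℤ)) p.2) (f ∘ Subtype.val)) := by
    intro i n₀ φ hφ
    have e : (fun p : Fin (n₀ + n₀ + 1) × Fin ny =>
          insertAtZero (f ∘ B i) (fun t s => mkUP W (d' t s)) ((p.1 : ℕ) - (n₀ : ℤ)) p.2)
        = fun p => mkUP W (fun n => insertAtZero (B i)
            (fun t : {i : ℤ // i ≠ 0} => G n ((t : ℤ) + n).toNat) ((p.1 : ℕ) - (n₀ : ℤ)) p.2) := by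
      ext p
      unfold insertAtZero
      by_cases h : ((p.1 : ℕ) : ℤ) - n₀ = 0
      · simp only [h, dif_pos]; rfl
      · simp only [h]; rfl
    rw [e, realize_UP]
    have hev : ∀ᶠ n in (W : Filter ℕ), n₀ ≤ n :=
      (Nat.hyperfilter_le_atTop) (Filter.eventually_ge_atTop n₀)
    filter_upwards [hev] with n hn
    have h1 := (hG n i).comp' (fun p : Fin (n₀ + n₀ + 1) × Fin ny =>
      ((⟨p.1 + (n - n₀), by omega⟩ : Fin (n + n + 1)), p.2))
    have h2 := hb.1 (n₀ + n₀ + 1) (fun p => p + (n - n₀)) (fun p => p)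
      (fun x y h => Nat.add_lt_add_right h _) (fun x y h => h)
    have h3 := h1.trans' h2
    rw [range_val_M, sameTypeOver_range_iff] at h3
    have h4 := (h3 φ).2 hφ
    convert h4 using 3 with p
    rw [insertAtZero_eq _ _ _ _ (by omega)]
    have : (((p.1 : ℕ) : ℤ) - n₀ + n).toNat = p.1 + (n - n₀) := by omega
    rw [this]
    rfl
  let A : Set N := M ∪ Set.range (Function.uncurry B)
  let v : ℕ → (W : Filter ℕ).Product (fun _ => N) := fun k =>
    (Encodable.decode k : Option ({i : ℤ // i ≠ 0} × Fin ny)).elim (f (Classical.arbitrary N))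
      (fun t => mkUP W (d' t.1 t.2))
  obtain ⟨g, hg⟩ := sat_seq hsat f A (by
    intro C hC
    rw [Set.union_assoc]
    exact small_union M _ ((Set.countable_range _).union hC)) v
  refine ⟨fun t s => g (Encodable.encode (t, s)), fun i n₀ => SameTypeOver.symm' ?_⟩
  refine sameType_of_imp (range_val_M M) fun φ hφ => ?_
  let τ : (Fin (n₀ + n₀ + 1) × Fin ny) ⊕ M → A ⊕ ℕ := Sum.elim
    (fun p => if h : ((p.1 : ℕ) : ℤ) - n₀ = 0 then Sum.inl ⟨B i p.2, Or.inr ⟨(i, p.2), rfl⟩⟩ else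
      Sum.inr (Encodable.encode ((⟨_, h⟩, p.2) : {i : ℤ // i ≠ 0} × Fin ny)))
    (fun m => Sum.inl ⟨m, Or.inl m.2⟩)
  have h1 := key i n₀ φ hφ
  have h2 := hg (φ.relabel τ)
  rw [Formula.realize_relabel, Formula.realize_relabel] at h2
  have e1 : Sum.elim (f ∘ Subtype.val) v ∘ τ
      = Sum.elim (fun p => insertAtZero (f ∘ B i) (fun t s => mkUP W (d' t s))
        ((p.1 : ℕ) - (n₀ : ℤ)) p.2) (f ∘ Subtype.val) := by
    ext (p | m)
    · by_cases h : ((p.1 : ℕ) : ℤ) - n₀ = 0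
      · simp [τ, insertAtZero, h]
      · simp [τ, insertAtZero, h, v]
    · rfl
  have e2 : Sum.elim Subtype.val g ∘ τ
      = Sum.elim (fun p : Fin (n₀ + n₀ + 1) × Fin ny => insertAtZero (B i)
        (fun t s => g (Encodable.encode (t, s)))
        ((p.1 : ℕ) - (n₀ : ℤ)) p.2) Subtype.val := by
    ext (p | m)
    · by_cases h : ((p.1 : ℕ) : ℤ) - n₀ = 0
      · simp [τ, insertAtZero, h]
      · simp [τ, insertAtZero, h]
    · rfl
  rw [e1, e2] at h2
  exact h2.1 h1

end Aux

/-- Lemma 3.1 of the paper: fitting indiscernible sequences around sets.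
Let `M ⪯ N` be models of a complete NIP theory with `N` sufficiently saturated
(`|M|⁺`-saturated). Let `q(y)` be a complete type over `M` (encoded by a realization `q` in
`N`), let `b` be a strict Morley sequence for `q(y)` in `N`, and let `B 0, ..., B (j-1)` be
finitely many tuples from `N` realizing `q`. Then there is a sequence `(d_n)_{n ∈ ℤ, n ≠ 0}`
of tuples from `N` such that for each `d ∈ B`, the sequence `(..., d₋₂, d₋₁, d, d₁, d₂, ...)`
(with `d` inserted at position `0`) is indiscernible over `M` and has the same
Ehrenfeucht–Mostowski type over `M` as `b`. -/
theorem statement6 {L : FirstOrder.Language.{u, v}} {N : Type w} [L.Structure N]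
    (M : L.ElementarySubstructure N) (hNIP : IsNIP L N)
    (hsat : IsSaturated L (Order.succ (Cardinal.mk M)) N)
    (ny : ℕ) (q : Fin ny → N) (b : ℕ → Fin ny → N)
    (hb : IsStrictMorleySequence L (M : Set N) q b)
    (j : ℕ) (B : Fin j → Fin ny → N)
    (hB : ∀ i, SameTypeOver L (M : Set N) (B i) q) :
    ∃ d : {i : ℤ // i ≠ 0} → Fin ny → N,
      ∀ i : Fin j,
        IsIndiscernibleOver L (M : Set N) (insertAtZero (B i) d) ∧
        SameEMTypeOver L (M : Set N) (insertAtZero (B i) d) b := by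

  rcases isEmpty_or_nonempty N with hN | hN
  · refine ⟨fun _ s => q s, fun i => ⟨fun m i j _ _ => ?_, fun m i j _ _ => ?_⟩⟩ <;>
    · intro p φ c _
      rw [Subsingleton.elim (fun x : Fin m × Fin ny => _) (fun x : Fin m × Fin ny => _)]
  · obtain ⟨d, hd⟩ := exists_seq hNIP M hsat q b hb B hB
    have hEM : ∀ i, SameEMTypeOver L (M : Set N) (insertAtZero (B i) d) b := by
      intro i m i' j' hi' hj'
      let n₀ : ℕ := Finset.univ.sup (fun k => (i' k).natAbs)
      have hn₀ : ∀ k, (i' k).natAbs ≤ n₀ := fun k =>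
        Finset.le_sup (f := fun k => (i' k).natAbs) (Finset.mem_univ k)
      have h1 := (hd i n₀).comp' (fun p : Fin m × Fin ny =>
        ((⟨(i' p.1 + n₀).toNat, by have := hn₀ p.1; omega⟩ : Fin (n₀ + n₀ + 1)), p.2))
      have h2 := hb.1 m (fun k => (i' k + n₀).toNat) j' (by
        intro x y h
        have := hi' h
        have h3 := hn₀ x
        have h4 := hn₀ y
        show (i' x + n₀).toNat < (i' y + n₀).toNat
        omega) hj'
      refine (h1.congr' ?_ (fun _ => rfl)).trans' h2
      rintro ⟨k, s⟩
      have h3 := hn₀ k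
      have : (((i' k + n₀).toNat : ℕ) : ℤ) - n₀ = i' k := by omega
      simp only [Function.comp_apply, this]
    refine ⟨d, fun i => ⟨fun m i' j' hi' hj' => ?_, hEM i⟩⟩
    exact (hEM i m i' (fun k => k) hi' (fun _ _ h => h)).trans'
      (hEM i m j' (fun k => k) hj' (fun _ _ h => h)).symm'

end DistalPaper
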